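/- arXiv:1602.08179 — 3 statements merged into one kernel-verified Lean document; each statement's English description precedes it below -/
import Mathlib

section
/- Let α ∈ 𝔫^ℤ be a sequence over a finite alphabet 𝔫. (i) For all p, q ≥ 1, if Per_p(α) ⊆ Per_q(α) then Per_{gcd(p,q)}(α) = Per_p(α). (ii) If p and q are essential periods of α, then lcm(p,q) is an essential period of α. -/
open Filter Topology TopologicalSpace Set

/-- The left-shift map on bi-infinite sequences. -/
def shiftMap (A : Type) (x : ℤ → A) : ℤ → A := fun i => x (i + 1)

/-- `Per p x` is the set of indices `i` at which `x` is periodic with period `p`. -/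
def Per (A : Type) (p : ℕ) (x : ℤ → A) : Set ℤ := {i : ℤ | ∀ k : ℤ, x (i + p * k) = x i}

/-- A sequence is periodic if it is invariant under shifting by some `p ≥ 1`. -/
def IsPeriodicSeq (A : Type) (x : ℤ → A) : Prop := ∃ p : ℕ, 1 ≤ p ∧ ∀ i : ℤ, x (i + p) = x i

/-- A (non-periodic) Toeplitz sequence: every symbol occurs periodically. -/
def IsToeplitzSeq (A : Type) (x : ℤ → A) : Prop :=
  ¬ IsPeriodicSeq A x ∧ ∀ i : ℤ, ∃ j : ℕ, 1 ≤ j ∧ ∀ k : ℤ, x (i + k * j) = x i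

/-- `p` is an essential period of `x`. -/
def IsEssentialPeriod (A : Type) (x : ℤ → A) (p : ℕ) : Prop :=
  1 ≤ p ∧ (Per A p x).Nonempty ∧ ∀ q : ℕ, 1 ≤ q → q < p → Per A p x ≠ Per A q x


theorem Per_subset_of_dvd {A : Type} (x : ℤ → A) {p q : ℕ} (h : p ∣ q) :
    Per A p x ⊆ Per A q x := by
  rintro i hi k
  obtain ⟨c, rfl⟩ := h
  have := hi (c * k)
  rwa [← mul_assoc, ← Nat.cast_mul] at this

theorem Per_gcd_eq_of_subset {A : Type} (x : ℤ → A) {p q : ℕ} (h : Per A p x ⊆ Per A q x) :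
    Per A (Nat.gcd p q) x = Per A p x := by
  refine Set.Subset.antisymm (Per_subset_of_dvd x (Nat.gcd_dvd_left p q)) ?_
  intro i hi k
  have hshift : i + p * (p.gcdA q * k) ∈ Per A p x := by
    intro m
    rw [add_assoc, ← mul_add, hi, hi]
  have hq := h hshift (p.gcdB q * k)
  rw [hi] at hq
  rw [← hq, Nat.gcd_eq_gcd_ab]
  congr 1
  ring

theorem IsEssentialPeriod.dvd_of_Per_subset {A : Type} {x : ℤ → A} {p r : ℕ}
    (hp : IsEssentialPeriod A x p) (h : Per A p x ⊆ Per A r x) : p ∣ r := by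
  obtain ⟨hpos, -, hmin⟩ := hp
  have hle : p ≤ Nat.gcd p r := by
    by_contra! hlt
    exact hmin _ (Nat.gcd_pos_of_pos_left r hpos) hlt (Per_gcd_eq_of_subset x h).symm
  have heq : Nat.gcd p r = p := (Nat.gcd_le_left r hpos).antisymm hle
  exact Nat.gcd_eq_left_iff_dvd.mp heq

/-- (i) if `Per_p(α) ⊆ Per_q(α)` then `Per_{gcd(p,q)}(α) = Per_p(α)`;
(ii) the lcm of two essential periods is an essential period. -/
theorem stmt16 {A : Type} [Fintype A] (h2 : 2 ≤ Fintype.card A) (x : ℤ → A) :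
    (∀ p q : ℕ, 1 ≤ p → 1 ≤ q → Per A p x ⊆ Per A q x →
      Per A (Nat.gcd p q) x = Per A p x) ∧
    (∀ p q : ℕ, IsEssentialPeriod A x p → IsEssentialPeriod A x q →
      IsEssentialPeriod A x (Nat.lcm p q)) := by
  refine ⟨fun p q _ _ h => Per_gcd_eq_of_subset x h, fun p q hp hq => ?_⟩
  have hpl : Per A p x ⊆ Per A (Nat.lcm p q) x := Per_subset_of_dvd x (Nat.dvd_lcm_left p q)
  have hql : Per A q x ⊆ Per A (Nat.lcm p q) x := Per_subset_of_dvd x (Nat.dvd_lcm_right p q)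
  refine ⟨Nat.lcm_pos hp.1 hq.1, hp.2.1.mono hpl, fun r hr hlt heq => ?_⟩
  have hdvd : Nat.lcm p q ∣ r :=
    Nat.lcm_dvd (hp.dvd_of_Per_subset (heq ▸ hpl)) (hq.dvd_of_Per_subset (heq ▸ hql))
  exact (Nat.le_of_dvd hr hdvd).not_gt hlt
end

section
/- Let α be a Toeplitz sequence over the alphabet 𝔫 and let γ be any element of the closure of the σ-orbit {σ^n(α) : n ∈ ℕ} of α. Then for every p ≥ 1, p is an essential period of α if and only if p is an essential period of γ. -/
open Filter Topology TopologicalSpace Set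

/-- The closure of the forward `σ`-orbit of `x`. -/
def orbitClosure (A : Type) [TopologicalSpace A] (x : ℤ → A) : Set (ℤ → A) :=
  closure {y | ∃ n : ℕ, y = (shiftMap A)^[n] x}


theorem shiftMap_iterate_apply (A : Type) (n : ℕ) (x : ℤ → A) (i : ℤ) :
    (shiftMap A)^[n] x i = x (i + n) := by
  induction n generalizing i with
  | zero => simp
  | succ n ih =>
    rw [Function.iterate_succ_apply', shiftMap, ih]
    congr 1
    push_cast
    ring

/-- Every point of the orbit closure is approximated on finite windows by shifts whose exponents
lie in a single residue class modulo `m`. -/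
theorem exists_residue_of_mem_orbitClosure {A : Type} [TopologicalSpace A] [DiscreteTopology A]
    {α γ : ℤ → A} (hγ : γ ∈ orbitClosure A α) {m : ℕ} (hm : 1 ≤ m) :
    ∃ t : ℕ, ∀ F : Finset ℤ, ∃ n : ℕ, n % m = t ∧ ∀ i ∈ F, α (i + n) = γ i := by
  have hS : {y | ∃ n : ℕ, y = (shiftMap A)^[n] α} =
      ⋃ t : Fin m, {y | ∃ n : ℕ, n % m = t ∧ y = (shiftMap A)^[n] α} := by
    ext y
    simp only [mem_ofPred_eq, mem_iUnion]
    constructor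
    · rintro ⟨n, rfl⟩
      exact ⟨⟨n % m, Nat.mod_lt _ hm⟩, n, rfl, rfl⟩
    · rintro ⟨_, n, _, rfl⟩
      exact ⟨n, rfl⟩
  rw [orbitClosure, hS, closure_iUnion_of_finite, mem_iUnion] at hγ
  obtain ⟨t, ht⟩ := hγ
  refine ⟨t, fun F => ?_⟩
  have hopen : IsOpen ((F : Set ℤ).pi fun i => ({γ i} : Set A)) :=
    isOpen_set_pi F.finite_toSet fun i _ => isOpen_discrete _
  obtain ⟨y, hy, n, hn, rfl⟩ := mem_closure_iff.1 ht _ hopen fun i _ => rfl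
  refine ⟨n, hn, fun i hi => ?_⟩
  rw [← shiftMap_iterate_apply A n α i]
  exact hy i hi

/-- The `p`-periodic part of a limit of shifts of `α` with exponents congruent to `t` modulo `m`
is the `p`-periodic part of `α` translated by `t`, whenever `p ∣ m`. -/
theorem mem_Per_iff_add_mem_Per {A : Type} {α γ : ℤ → A}
    (hα : ∀ i : ℤ, ∃ j : ℕ, 1 ≤ j ∧ ∀ k : ℤ, α (i + k * j) = α i) {m t : ℕ}
    (ht : ∀ F : Finset ℤ, ∃ n : ℕ, n % m = t ∧ ∀ i ∈ F, α (i + n) = γ i)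
    {p : ℕ} (hpm : p ∣ m) (i : ℤ) : i ∈ Per A p γ ↔ i + t ∈ Per A p α := by
  have hdvd : ∀ n : ℕ, n % m = t → ∃ d : ℤ, (n : ℤ) = t + p * d := by
    intro n hn
    obtain ⟨c, rfl⟩ := hpm
    refine ⟨c * (n / (p * c) : ℕ), ?_⟩
    have h := Nat.mod_add_div n (p * c)
    rw [hn] at h
    rw [← mul_assoc]
    exact_mod_cast h.symm
  constructor
  · intro hi k
    obtain ⟨a, ha, ha'⟩ := hα (i + t)
    obtain ⟨b, hb, hb'⟩ := hα (i + t + p * k)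
    have hab : (0 : ℤ) < a * b := by positivity
    let F : Finset ℤ := (Finset.range (a * b)).image (fun l : ℕ => i + p * (l : ℤ)) ∪
      (Finset.range (a * b)).image (fun l : ℕ => i + p * ((l : ℤ) + k))
    obtain ⟨n, hn, hF⟩ := ht F
    obtain ⟨d, hd⟩ := hdvd n hn
    obtain ⟨l, hl⟩ := Int.eq_ofNat_of_zero_le (Int.emod_nonneg (-d) hab.ne')
    have hl' : l < a * b := by
      have := Int.emod_lt_of_pos (-d) hab
      rw [hl] at this
      exact_mod_cast this
    have hde : d + l = a * b * -(-d / (a * b)) := by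
      have := Int.emod_add_mul_ediv (-d) (a * b)
      rw [hl] at this
      linarith
    generalize -(-d / ((a : ℤ) * b)) = e at hde
    have h₁ := hF (i + p * (l : ℤ)) (Finset.mem_union_left _
      (Finset.mem_image_of_mem _ (Finset.mem_range.2 hl')))
    have h₂ := hF (i + p * ((l : ℤ) + k)) (Finset.mem_union_right _
      (Finset.mem_image.2 ⟨l, Finset.mem_range.2 hl', rfl⟩))
    rw [hi] at h₁ h₂
    have e₁ : i + p * (l : ℤ) + n = i + t + (p * b * e) * a := by
      rw [hd]; linear_combination (p : ℤ) * hde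
    have e₂ : i + p * ((l : ℤ) + k) + n = i + t + p * k + (p * a * e) * b := by
      rw [hd]; linear_combination (p : ℤ) * hde
    rw [e₁, ha'] at h₁
    rw [e₂, hb'] at h₂
    rw [h₁, h₂]
  · intro hi k
    obtain ⟨n, hn, hF⟩ := ht {i, i + p * k}
    obtain ⟨d, hd⟩ := hdvd n hn
    rw [← hF i (by simp), ← hF (i + p * k) (by simp), hd,
      show i + p * k + (t + p * d) = i + t + p * (k + d) by ring, ← add_assoc, hi, hi]

/-- a Toeplitz sequence and any element of its orbit closure have exactly the
same essential periods. -/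
theorem stmt18 {A : Type} [Fintype A] (h2 : 2 ≤ Fintype.card A)
    [TopologicalSpace A] [DiscreteTopology A]
    (α : ℤ → A) (hα : IsToeplitzSeq A α)
    (γ : ℤ → A) (hγ : γ ∈ orbitClosure A α) :
    ∀ p : ℕ, 1 ≤ p → (IsEssentialPeriod A α p ↔ IsEssentialPeriod A γ p) := by
  intro p hp
  have key : ∀ q : ℕ, 1 ≤ q → ∃ t : ℤ, Per A p γ = (· + t) ⁻¹' Per A p α ∧
      Per A q γ = (· + t) ⁻¹' Per A q α := by
    intro q hq
    obtain ⟨t, ht⟩ := exists_residue_of_mem_orbitClosure hγ (Nat.mul_pos hp hq)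
    exact ⟨t, Set.ext (mem_Per_iff_add_mem_Per hα.2 ht (dvd_mul_right p q)),
      Set.ext (mem_Per_iff_add_mem_Per hα.2 ht (dvd_mul_left q p))⟩
  have hne : (Per A p α).Nonempty ↔ (Per A p γ).Nonempty := by
    obtain ⟨t, ht, -⟩ := key p hp
    rw [ht, (add_right_surjective t).nonempty_preimage]
  have heq : ∀ q : ℕ, 1 ≤ q → (Per A p α = Per A q α ↔ Per A p γ = Per A q γ) := by
    intro q hq
    obtain ⟨t, ht, ht'⟩ := key q hq
    rw [ht, ht', (add_right_surjective t).preimage_injective.eq_iff]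
  unfold IsEssentialPeriod
  rw [hne]
  refine and_congr_right fun _ => and_congr_right fun _ => forall_congr' fun q =>
    forall_congr' fun hq => forall_congr' fun _ => not_congr (heq q hq)
end

section
/- Let α be a Toeplitz sequence over the alphabet 𝔫 and let O be the closure of {σ^n(α) : n ∈ ℕ} in 𝔫^ℤ. Then α is an almost periodic point of (O, σ) and O is a minimal subshift: O is a nonempty closed infinite set with σ[O] = O, and every nonempty closed subset Y ⊆ O with σ[Y] ⊆ Y equals O. -/
open Filter Topology TopologicalSpace Set

/-- A subshift: a nonempty closed infinite shift-invariant set (with `σ[O] = O`). -/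
def IsSubshift (A : Type) [TopologicalSpace A] (O : Set (ℤ → A)) : Prop :=
  O.Nonempty ∧ IsClosed O ∧ O.Infinite ∧ shiftMap A '' O = O

theorem continuous_shiftMap (A : Type) [TopologicalSpace A] : Continuous (shiftMap A) :=
  continuous_pi fun i => continuous_apply (i + 1)

/-- Every neighborhood of a Toeplitz sequence contains its shifts by all multiples of some period. -/
theorem exists_period_of_mem_isOpen {A : Type} [TopologicalSpace A] {α : ℤ → A}
    (hα : IsToeplitzSeq A α) {U : Set (ℤ → A)} (hU : IsOpen U) (hαU : α ∈ U) :
    ∃ p : ℕ, 1 ≤ p ∧ ∀ k : ℕ, (shiftMap A)^[k * p] α ∈ U := by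
  obtain ⟨I, u, hu, hsub⟩ := isOpen_pi_iff.1 hU α hαU
  choose j hj hper using hα.2
  refine ⟨∏ i ∈ I, j i, Nat.succ_le_of_lt (Finset.prod_pos fun i _ => hj i), fun k => hsub fun i hi => ?_⟩
  obtain ⟨c, hc⟩ := Finset.dvd_prod_of_mem j hi
  have h := hper i (k * c)
  rw [shiftMap_iterate_apply, hc]
  have e : i + ((k * (j i * c) : ℕ) : ℤ) = i + (k * c : ℤ) * j i := by
    push_cast
    ring
  rw [e, h]
  exact (hu i hi).2

/-- A Toeplitz sequence is almost periodic under the shift. -/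
theorem IsToeplitzSeq.exists_bounded_gaps {A : Type} [TopologicalSpace A] {α : ℤ → A}
    (hα : IsToeplitzSeq A α) {U : Set (ℤ → A)} (hU : IsOpen U) (hαU : α ∈ U) :
    ∃ l : ℕ, 1 ≤ l ∧ ∀ n : ℕ, ∃ i : ℕ, n ≤ i ∧ i ≤ n + l ∧ (shiftMap A)^[i] α ∈ U := by
  obtain ⟨p, hp, h⟩ := exists_period_of_mem_isOpen hα hU hαU
  refine ⟨p, hp, fun n => ⟨(n / p + 1) * p, ?_, ?_, h _⟩⟩
  · rw [mul_comm]
    exact (Nat.lt_mul_div_succ n hp).le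
  · rw [add_mul, one_mul]
    exact Nat.add_le_add_right (Nat.div_mul_le_self n p) p

theorem mem_orbitClosure {A : Type} [TopologicalSpace A] (α : ℤ → A) (n : ℕ) :
    (shiftMap A)^[n] α ∈ orbitClosure A α :=
  subset_closure ⟨n, rfl⟩

theorem image_shiftMap_orbitClosure_subset {A : Type} [TopologicalSpace A] (α : ℤ → A) :
    shiftMap A '' orbitClosure A α ⊆ orbitClosure A α := by
  refine (image_closure_subset_closure_image (continuous_shiftMap A)).trans (closure_mono ?_)
  rintro _ ⟨_, ⟨n, rfl⟩, rfl⟩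
  exact ⟨n + 1, (Function.iterate_succ_apply' _ _ _).symm⟩

/-- A closed set mapped into itself by the shift contains the orbit closure of each of its points. -/
theorem orbitClosure_subset {A : Type} [TopologicalSpace A] {α : ℤ → A} {Y : Set (ℤ → A)}
    (hY : IsClosed Y) (hσ : shiftMap A '' Y ⊆ Y) (hαY : α ∈ Y) : orbitClosure A α ⊆ Y := by
  refine closure_minimal ?_ hY
  rintro _ ⟨n, rfl⟩
  exact (mapsTo_iff_image_subset.2 hσ).iterate n hαY

theorem orbitClosure_infinite {A : Type} [TopologicalSpace A] {α : ℤ → A}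
    (hα : ¬ IsPeriodicSeq A α) : (orbitClosure A α).Infinite := by
  refine infinite_of_injective_forall_mem (f := fun n : ℕ => (shiftMap A)^[n] α) ?_
    (mem_orbitClosure α)
  refine Function.Injective.of_lt_imp_ne fun m n hmn h => hα ⟨n - m, by omega, fun i => ?_⟩
  have h' := congrFun h (i - m)
  simp only [shiftMap_iterate_apply] at h'
  rw [Nat.cast_sub hmn.le]
  convert h'.symm using 2 <;> ring

theorem IsToeplitzSeq.image_shiftMap_orbitClosure {A : Type} [Finite A] [TopologicalSpace A]
    [DiscreteTopology A] {α : ℤ → A} (hα : IsToeplitzSeq A α) :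
    shiftMap A '' orbitClosure A α = orbitClosure A α := by
  have hcl : IsClosed (shiftMap A '' orbitClosure A α) :=
    (isClosed_closure.isCompact.image (continuous_shiftMap A)).isClosed
  refine (image_shiftMap_orbitClosure_subset α).antisymm
    (orbitClosure_subset hcl (image_mono (image_shiftMap_orbitClosure_subset α)) ?_)
  rw [← hcl.closure_eq, mem_closure_iff]
  intro U hU hαU
  obtain ⟨p, hp, h⟩ := exists_period_of_mem_isOpen hα hU hαU
  obtain ⟨q, rfl⟩ := Nat.exists_eq_add_of_le' hp
  refine ⟨_, h 1, _, mem_orbitClosure α q, ?_⟩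
  rw [one_mul, Function.iterate_succ_apply']

theorem IsToeplitzSeq.eq_orbitClosure {A : Type} [TopologicalSpace A] [RegularSpace A]
    {α : ℤ → A} (hα : IsToeplitzSeq A α) {Y : Set (ℤ → A)} (hne : Y.Nonempty) (hY : IsClosed Y)
    (hsub : Y ⊆ orbitClosure A α) (hσ : shiftMap A '' Y ⊆ Y) : Y = orbitClosure A α := by
  refine hsub.antisymm (orbitClosure_subset hY hσ ?_)
  obtain ⟨y, hy⟩ := hne
  rw [← hY.closure_eq, mem_closure_iff]
  intro U hU hαU
  obtain ⟨K, hK, hKcl, hKU⟩ := exists_mem_nhds_isClosed_subset (hU.mem_nhds hαU)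
  obtain ⟨l, -, hl⟩ := hα.exists_bounded_gaps isOpen_interior (mem_interior_iff_mem_nhds.2 hK)
  have hcl : IsClosed (⋃ i ∈ Iic l, (shiftMap A)^[i] ⁻¹' K) :=
    (finite_Iic l).isClosed_biUnion fun i _ => hKcl.preimage ((continuous_shiftMap A).iterate i)
  have hcover : orbitClosure A α ⊆ ⋃ i ∈ Iic l, (shiftMap A)^[i] ⁻¹' K := by
    refine closure_minimal ?_ hcl
    rintro _ ⟨n, rfl⟩
    obtain ⟨i, hni, hil, hi⟩ := hl n
    refine mem_biUnion (x := i - n) (by simp only [mem_Iic]; omega) ?_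
    rw [mem_preimage, ← Function.iterate_add_apply, Nat.sub_add_cancel hni]
    exact interior_subset hi
  obtain ⟨i, -, hi⟩ := mem_iUnion₂.1 (hcover (hsub hy))
  exact ⟨_, hKU hi, (mapsTo_iff_image_subset.2 hσ).iterate i hy⟩

/-- the orbit closure `O` of a Toeplitz sequence `α` is a minimal subshift and
`α` is an almost periodic point of `(O, σ)`: its set of return times to any open
neighborhood has bounded gaps. -/
theorem stmt19 {A : Type} [Fintype A] (h2 : 2 ≤ Fintype.card A)
    [TopologicalSpace A] [DiscreteTopology A]
    (α : ℤ → A) (hα : IsToeplitzSeq A α) :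
    -- α is almost periodic
    (∀ U : Set (ℤ → A), IsOpen U → α ∈ U →
      ∃ l : ℕ, 1 ≤ l ∧ ∀ n : ℕ, ∃ i : ℕ, n ≤ i ∧ i ≤ n + l ∧ (shiftMap A)^[i] α ∈ U) ∧
    -- the orbit closure is a subshift
    IsSubshift A (orbitClosure A α) ∧
    -- minimality
    (∀ Y : Set (ℤ → A), Y.Nonempty → IsClosed Y → Y ⊆ orbitClosure A α →
      shiftMap A '' Y ⊆ Y → Y = orbitClosure A α) := by
  exact ⟨fun _ hU hαU => hα.exists_bounded_gaps hU hαU,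
    ⟨⟨α, mem_orbitClosure α 0⟩, isClosed_closure, orbitClosure_infinite hα.1,
      hα.image_shiftMap_orbitClosure⟩,
    fun _ hne hY hsub hσ => hα.eq_orbitClosure hne hY hsub hσ⟩
end
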